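/- arXiv:1910.07744 — 2 statements merged into one kernel-verified Lean document; each statement's English description precedes it below -/
import Mathlib

section
/- Fix an integer n ≥ 1 and a finite set E of directed labelled edges, i.e. a finite set of triples (u, v, k) with u, v ∈ {1,…,n} and k ∈ ℤ³. For a placement x : {1,…,n} → ℝ³ consider the family of closed segments S(x) = { [x_u + m, x_v + k + m] : (u,v,k) ∈ E, m ∈ ℤ³ }. Call x proper if (i) the points x_u + m, for u ∈ {1,…,n} and m ∈ ℤ³, are pairwise distinct, (ii) every segment in S(x) is nondegenerate, and (iii) any two distinct segments of S(x) are essentially disjoint (their intersection is contained in the set of points that are endpoints of both). Then the image of the set of proper placements under the quotient map (ℝ³)ⁿ → (ℝ³/ℤ³)ⁿ has finitely many connected components. -/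
/-- The real vector in `ℝ³` corresponding to an integer vector in `ℤ³`. -/
def intVec (m : Fin 3 → ℤ) : Fin 3 → ℝ := fun i => (m i : ℝ)

/-- A placement `x : {1,…,n} → ℝ³` of the vertices of a labelled quotient graph with
edge data `E` is proper if the lattice translates of the nodes are pairwise distinct,
all the segments of the induced periodic net are nondegenerate, and any two distinct
such segments are essentially disjoint. -/
def ProperPlacement {n : ℕ} (E : Finset (Fin n × Fin n × (Fin 3 → ℤ)))
    (x : Fin n → Fin 3 → ℝ) : Prop :=
  (∀ u u' : Fin n, ∀ m m' : Fin 3 → ℤ,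
      x u + intVec m = x u' + intVec m' → u = u' ∧ m = m') ∧
  (∀ e ∈ E, ∀ m : Fin 3 → ℤ,
      x e.1 + intVec m ≠ x e.2.1 + intVec e.2.2 + intVec m) ∧
  (∀ e ∈ E, ∀ e' ∈ E, ∀ m m' : Fin 3 → ℤ,
      segment ℝ (x e.1 + intVec m) (x e.2.1 + intVec e.2.2 + intVec m) ≠
        segment ℝ (x e'.1 + intVec m') (x e'.2.1 + intVec e'.2.2 + intVec m') →
      ∀ p, p ∈ segment ℝ (x e.1 + intVec m) (x e.2.1 + intVec e.2.2 + intVec m) →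
        p ∈ segment ℝ (x e'.1 + intVec m') (x e'.2.1 + intVec e'.2.2 + intVec m') →
        (p = x e.1 + intVec m ∨ p = x e.2.1 + intVec e.2.2 + intVec m) ∧
        (p = x e'.1 + intVec m' ∨ p = x e'.2.1 + intVec e'.2.2 + intVec m'))

open Topology Set

/-- A set is covered by the path classes of finitely many of its points. -/
def FinitelyManyPathClasses {X : Type*} [TopologicalSpace X] (S : Set X) : Prop :=
  ∃ F : Set X, F.Finite ∧ ∀ x ∈ S, ∃ y ∈ F, JoinedIn S x y

theorem JoinedIn.image_of_continuous {X Y : Type*} [TopologicalSpace X] [TopologicalSpace Y]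
    {S : Set X} {T : Set Y} {x y : X} (h : JoinedIn S x y) {φ : X → Y} (hφ : Continuous φ)
    (hST : MapsTo φ S T) : JoinedIn T (φ x) (φ y) :=
  ⟨h.somePath.map hφ, fun t => hST (h.somePath_mem t)⟩

/-- A point property that is locally constant on a set is constant along paths in the set. -/
theorem Path.forall_of_locally_iff {X : Type*} [TopologicalSpace X] {S : Set X} {x y : X}
    (γ : Path x y) (hγS : ∀ t, γ t ∈ S) {T : X → Prop}
    (hT : ∀ z ∈ S, ∀ᶠ w in 𝓝 z, w ∈ S → (T w ↔ T z)) (hx : T x) (t : unitInterval) :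
    T (γ t) := by
  have hγ : ∀ t, ∀ᶠ s in 𝓝 t, T (γ s) ↔ T (γ t) := fun t => by
    filter_upwards [γ.continuous.continuousAt.eventually (hT _ (hγS t))] with s hs
    exact hs (hγS s)
  have hclopen : IsClopen {t | T (γ t)} := by
    constructor
    · rw [← isOpen_compl_iff, isOpen_iff_mem_nhds]
      intro t ht
      filter_upwards [hγ t] with s hs
      exact fun h' => ht (hs.1 h')
    · rw [isOpen_iff_mem_nhds]
      intro t ht
      filter_upwards [hγ t] with s hs
      exact hs.2 ht
  exact (hclopen.eq_univ ⟨0, by simpa using hx⟩).superset (mem_univ t)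

theorem JoinedIn.of_locally_iff {X : Type*} [TopologicalSpace X] {S : Set X} {x y : X}
    (h : JoinedIn S x y) {T : X → Prop} (hT : ∀ z ∈ S, ∀ᶠ w in 𝓝 z, w ∈ S → (T w ↔ T z))
    (hx : T x) : T y := by
  simpa using h.somePath.forall_of_locally_iff h.somePath_mem hT hx 1

/-- Finiteness of the number of path classes passes to relatively open and closed subsets. -/
theorem FinitelyManyPathClasses.inter_of_locally_iff {X : Type*} [TopologicalSpace X]
    {S Q : Set X} (hS : FinitelyManyPathClasses S)
    (hQ : ∀ z ∈ S, ∀ᶠ w in 𝓝 z, w ∈ S → (w ∈ Q ↔ z ∈ Q)) :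
    FinitelyManyPathClasses (S ∩ Q) := by
  obtain ⟨F, hF, h⟩ := hS
  refine ⟨F, hF, fun x hx => ?_⟩
  obtain ⟨y, hy, hxy⟩ := h x hx.1
  exact ⟨y, hy, hxy.somePath, fun t => ⟨hxy.somePath_mem t,
    hxy.somePath.forall_of_locally_iff hxy.somePath_mem (T := (· ∈ Q)) hQ hx.2 t⟩⟩

/-- Connectedness to finitely many points can be tested on a subset that is reachable. -/
theorem FinitelyManyPathClasses.of_reachable {X : Type*} [TopologicalSpace X] {S D : Set X}
    (hD : FinitelyManyPathClasses D) (hDS : D ⊆ S) (h : ∀ x ∈ S, ∃ y ∈ D, JoinedIn S x y) :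
    FinitelyManyPathClasses S := by
  obtain ⟨F, hF, hFD⟩ := hD
  refine ⟨F, hF, fun x hx => ?_⟩
  obtain ⟨y, hy, hxy⟩ := h x hx
  obtain ⟨z, hz, hyz⟩ := hFD y hy
  exact ⟨z, hz, hxy.trans (hyz.mono hDS)⟩

theorem FinitelyManyPathClasses.image {X Y : Type*} [TopologicalSpace X] [TopologicalSpace Y]
    {S : Set X} (hS : FinitelyManyPathClasses S) {φ : X → Y} (hφ : Continuous φ) :
    FinitelyManyPathClasses (φ '' S) := by
  obtain ⟨F, hF, h⟩ := hS
  refine ⟨φ '' F, hF.image φ, ?_⟩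
  rintro _ ⟨x, hx, rfl⟩
  obtain ⟨y, hy, hxy⟩ := h x hx
  exact ⟨φ y, mem_image_of_mem φ hy, hxy.image_of_continuous hφ (mapsTo_image φ S)⟩

theorem FinitelyManyPathClasses.finite_connectedComponents {X : Type*} [TopologicalSpace X]
    {S : Set X} (hS : FinitelyManyPathClasses S) : Finite (ConnectedComponents S) := by
  obtain ⟨F, hF, h⟩ := hS
  have hfin : ((↑) ⁻¹' F : Set S).Finite := hF.preimage Subtype.val_injective.injOn
  refine Set.finite_univ_iff.1 ((hfin.image ConnectedComponents.mk).subset ?_)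
  intro c _
  obtain ⟨x, rfl⟩ := ConnectedComponents.surjective_coe c
  obtain ⟨y, hy, hxy⟩ := h x x.2
  refine ⟨⟨y, hxy.target_mem⟩, hy, ?_⟩
  rw [ConnectedComponents.coe_eq_coe]
  exact (connectedComponent_eq (pathComponent_subset_component _ hxy.joined_subtype)).symm

/-- The complement of a finite set of reals has finitely many path classes. -/
theorem Set.Finite.finitelyManyPathClasses_compl {Z : Set ℝ} (hZ : Z.Finite) :
    FinitelyManyPathClasses Zᶜ := by
  let c : ℝ → Set ℝ := fun s => Z ∩ Iio s
  have hfin : (c '' Zᶜ).Finite := hZ.finite_subsets.subset (by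
    rintro _ ⟨s, -, rfl⟩
    exact inter_subset_left)
  have hjoin : ∀ x ∈ Zᶜ, ∀ y ∈ Zᶜ, x ≤ y → c x = c y → JoinedIn Zᶜ x y := by
    intro x _ y hy hxy hc
    refine JoinedIn.of_segment_subset ?_
    rw [segment_eq_Icc hxy]
    intro z hz hzZ
    have hzy : z ∈ c y := ⟨hzZ, lt_of_le_of_ne hz.2 fun h => hy (h ▸ hzZ)⟩
    rw [← hc] at hzy
    exact absurd hzy.2 (not_lt.2 hz.1)
  obtain ⟨F, hFZ, hF⟩ := exists_subset_bijOn Zᶜ c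
  refine ⟨F, (hF.finite_iff_finite).2 hfin, fun x hx => ?_⟩
  obtain ⟨y, hy, hxy⟩ := hF.surjOn (mem_image_of_mem c hx)
  refine ⟨y, hy, ?_⟩
  rcases le_total x y with h | h
  · exact hjoin x hx y (hFZ hy) h hxy.symm
  · exact (hjoin y (hFZ hy) x hx h hxy).symm

/-- Near a fibre all of whose zeros are simple, every point off the zero set can be moved
vertically off the zero set to a height at which there are no zeros nearby. -/
theorem eventually_exists_uIcc_ne_zero {Y : Type*} [TopologicalSpace Y] {φ ψ : Y → ℝ → ℝ}
    (hφ : Continuous fun p : Y × ℝ => φ p.1 p.2) (hψ : Continuous fun p : Y × ℝ => ψ p.1 p.2)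
    (hderiv : ∀ y s, HasDerivAt (φ y) (ψ y s) s) {y₀ : Y}
    (hsimple : ∀ s, φ y₀ s = 0 → ψ y₀ s ≠ 0) {R : ℝ}
    (hR : ∀ᶠ y in 𝓝 y₀, ∀ s, R ≤ |s| → φ y s ≠ 0) :
    ∃ B ∈ 𝓝 y₀, ∀ y ∈ B, ∀ s, φ y s ≠ 0 →
      ∃ s', (∀ r ∈ uIcc s s', φ y r ≠ 0) ∧ ∀ z ∈ B, φ z s' ≠ 0 := by
  have rolle : ∀ y a b, a < b → φ y a = 0 → φ y b = 0 → ∃ c ∈ Ioo a b, ψ y c = 0 := by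
    intro y a b hab ha hb
    exact exists_hasDerivAt_eq_zero hab
      (fun x _ => (hderiv y x).continuousAt.continuousWithinAt) (ha.trans hb.symm)
      fun x _ => hderiv y x
  have key : ∃ B ∈ 𝓝 y₀, ∀ y ∈ B, ∀ s ∈ Icc (-R) R, φ y s ≠ 0 →
      ∃ s', (∀ r ∈ uIcc s s', φ y r ≠ 0) ∧ ∀ z ∈ B, φ z s' ≠ 0 := by
    refine isCompact_Icc.induction_on (p := fun I : Set ℝ => ∃ B ∈ 𝓝 y₀, ∀ y ∈ B, ∀ s ∈ I,
      φ y s ≠ 0 → ∃ s', (∀ r ∈ uIcc s s', φ y r ≠ 0) ∧ ∀ z ∈ B, φ z s' ≠ 0) ?_ ?_ ?_ ?_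
    · exact ⟨univ, Filter.univ_mem, by simp⟩
    · rintro I J hIJ ⟨B, hB, h⟩
      exact ⟨B, hB, fun y hy s hs => h y hy s (hIJ hs)⟩
    · rintro I J ⟨B, hB, h⟩ ⟨B', hB', h'⟩
      refine ⟨B ∩ B', Filter.inter_mem hB hB', fun y hy s hs hne => ?_⟩
      rcases hs with hs | hs
      · obtain ⟨s', h1, h2⟩ := h y hy.1 s hs hne
        exact ⟨s', h1, fun z hz => h2 z hz.1⟩
      · obtain ⟨s', h1, h2⟩ := h' y hy.2 s hs hne
        exact ⟨s', h1, fun z hz => h2 z hz.2⟩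
    · intro s₀ _
      by_cases h0 : φ y₀ s₀ = 0
      · have hnear : ∀ᶠ p in 𝓝 (y₀, s₀), ψ p.1 p.2 ≠ 0 :=
          hψ.continuousAt.eventually_ne (hsimple s₀ h0)
        rw [nhds_prod_eq] at hnear
        obtain ⟨pB, hpB, pI, hpI, hBI⟩ := Filter.eventually_prod_iff.1 hnear
        obtain ⟨ε, hε, hball⟩ := Metric.eventually_nhds_iff.1 hpI
        set a := s₀ - ε / 2 with ha
        set b := s₀ + ε / 2 with hb
        have hI : ∀ r ∈ Icc a b, pI r := fun r hr => hball (by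
          rw [Real.dist_eq, abs_lt]; constructor <;> linarith [hr.1, hr.2])
        have hsub : ∀ y, pB y → ∀ c d, a ≤ c → c < d → d ≤ b → φ y c = 0 → φ y d ≠ 0 := by
          intro y hy c d hac hcd hdb hc hd
          obtain ⟨r, hr, hr0⟩ := rolle y c d hcd hc hd
          exact hBI hy (hI r ⟨hac.trans hr.1.le, hr.2.le.trans hdb⟩) hr0
        have hy₀ := hpB.self_of_nhds
        have hane : φ y₀ a ≠ 0 := fun h =>
          hsub y₀ hy₀ a s₀ le_rfl (by linarith) (by linarith) h h0
        have hbne : φ y₀ b ≠ 0 := hsub y₀ hy₀ s₀ b (by linarith) (by linarith) le_rfl h0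
        have hcont : ∀ s, Continuous fun y => φ y s := fun s =>
          hφ.comp (Continuous.prodMk_left s)
        have hBev : ∀ᶠ y in 𝓝 y₀, pB y ∧ φ y a ≠ 0 ∧ φ y b ≠ 0 :=
          hpB.and (((hcont a).continuousAt.eventually_ne hane).and
            ((hcont b).continuousAt.eventually_ne hbne))
        refine ⟨Icc a b, mem_nhdsWithin_of_mem_nhds (Icc_mem_nhds (by linarith) (by linarith)),
          _, hBev, fun y hy s hs hne => ?_⟩
        by_cases hzero : ∃ r ∈ Icc a s, φ y r = 0
        · obtain ⟨r, hr, hr0⟩ := hzero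
          have hrs : r < s := lt_of_le_of_ne hr.2 fun h => hne (h ▸ hr0)
          refine ⟨b, fun t ht => ?_, fun z hz => hz.2.2⟩
          rw [uIcc_of_le hs.2] at ht
          exact hsub y hy.1 r t hr.1 (hrs.trans_le ht.1) ht.2 hr0
        · push Not at hzero
          refine ⟨a, fun t ht => ?_, fun z hz => hz.2.1⟩
          rw [uIcc_of_ge hs.1] at ht
          exact hzero t ht
      · have hnear : ∀ᶠ p in 𝓝 (y₀, s₀), φ p.1 p.2 ≠ 0 := hφ.continuousAt.eventually_ne h0
        rw [nhds_prod_eq] at hnear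
        obtain ⟨pB, hpB, pI, hpI, hBI⟩ := Filter.eventually_prod_iff.1 hnear
        refine ⟨{s | pI s}, mem_nhdsWithin_of_mem_nhds hpI, {y | pB y}, hpB,
          fun y _ s hs hne => ⟨s, ?_, fun z hz => hBI hz hs⟩⟩
        simpa using hne
  obtain ⟨B, hB, h⟩ := key
  refine ⟨B ∩ {y | ∀ s, R ≤ |s| → φ y s ≠ 0}, Filter.inter_mem hB hR, fun y hy s hne => ?_⟩
  rcases le_total R |s| with hs | hs
  · exact ⟨s, by simpa using hne, fun z hz => hz.2 s hs⟩
  · obtain ⟨s', h1, h2⟩ := h y hy.1 s (abs_le.1 hs) hne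
    exact ⟨s', h1, fun z hz => h2 z hz.1⟩

open Polynomial in
/-- Every polynomial over a fraction field is, up to a nonzero constant, integral. -/
theorem exists_map_eq_C_mul {A K : Type*} [CommRing A] [IsDomain A] [Field K] [Algebra A K]
    [IsFractionRing A K] (p : K[X]) :
    ∃ b : A, b ≠ 0 ∧ ∃ q : A[X], q.map (algebraMap A K) = C (algebraMap A K b) * p := by
  obtain ⟨b, hb, h⟩ := IsLocalization.integerNormalization_spec (nonZeroDivisors A) p
  refine ⟨b, nonZeroDivisors.ne_zero hb, _, h.trans ?_⟩
  rw [← Polynomial.smul_eq_C_mul, algebraMap_smul]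

open Polynomial in
/-- Divisibility over the fraction field is divisibility up to a nonzero constant. -/
theorem exists_C_mul_dvd_of_map_dvd_map {A K : Type*} [CommRing A] [IsDomain A] [Field K]
    [Algebra A K] [IsFractionRing A K] {p q : A[X]}
    (h : p.map (algebraMap A K) ∣ q.map (algebraMap A K)) :
    ∃ b : A, b ≠ 0 ∧ p ∣ C b * q := by
  obtain ⟨c, hc⟩ := h
  obtain ⟨b, hb, c', hc'⟩ := exists_map_eq_C_mul (A := A) c
  refine ⟨b, hb, c', Polynomial.map_injective _ (IsFractionRing.injective A K) ?_⟩
  simp only [Polynomial.map_mul, hc, hc', map_C]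
  ring

open Polynomial in
/-- Over a domain of characteristic zero, a nonzero polynomial has, up to nonzero constants, the
same zeros as a polynomial which generates the unit ideal together with its derivative. -/
theorem exists_generic_squarefree_part {A : Type*} [CommRing A] [IsDomain A] [CharZero A]
    {f : A[X]} (hf : f ≠ 0) :
    ∃ (g : A[X]) (δ : A) (k : ℕ), g ≠ 0 ∧ δ ≠ 0 ∧ g ∣ C δ * f ∧ f ∣ C δ * g ^ k ∧
      ∃ a b, a * g + b * derivative g = C δ := by
  classical
  let K := FractionRing A
  have hinj := Polynomial.map_injective _ (IsFractionRing.injective A K)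
  have hC : ∀ a : A, a ≠ 0 → IsUnit (C (algebraMap A K a)) := fun a ha =>
    Polynomial.isUnit_C.2 (IsUnit.mk0 _ (by simpa using ha))
  have : CharZero K := charZero_of_injective_algebraMap (IsFractionRing.injective A K)
  have hF : f.map (algebraMap A K) ≠ 0 := by
    rwa [Ne, Polynomial.map_eq_zero_iff (IsFractionRing.injective A K)]
  set r := UniqueFactorizationMonoid.radical (f.map (algebraMap A K)) with hr
  obtain ⟨b₀, hb₀, g, hg⟩ := exists_map_eq_C_mul (A := A) r
  have hassoc : Associated r (g.map (algebraMap A K)) := by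
    rw [hg]; exact (associated_unit_mul_right _ _ (hC b₀ hb₀))
  have hrsep : (g.map (algebraMap A K)).Separable := by
    rw [PerfectField.separable_iff_squarefree]
    exact (hassoc.squarefree_iff).1 UniqueFactorizationMonoid.squarefree_radical
  obtain ⟨k, hk⟩ := UniqueFactorizationMonoid.exists_dvd_radical_self_pow hF
  have h1 : g.map (algebraMap A K) ∣ f.map (algebraMap A K) :=
    hassoc.symm.dvd.trans UniqueFactorizationMonoid.radical_dvd_self
  have h2 : f.map (algebraMap A K) ∣ (g ^ k).map (algebraMap A K) := by
    rw [Polynomial.map_pow]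
    exact hk.trans (hassoc.pow_pow).dvd
  obtain ⟨b₁, hb₁, h1⟩ := exists_C_mul_dvd_of_map_dvd_map h1
  obtain ⟨b₂, hb₂, h2⟩ := exists_C_mul_dvd_of_map_dvd_map h2
  obtain ⟨u, v, huv⟩ := hrsep
  obtain ⟨b₃, hb₃, u', hu⟩ := exists_map_eq_C_mul (A := A) u
  obtain ⟨b₄, hb₄, v', hv⟩ := exists_map_eq_C_mul (A := A) v
  refine ⟨g, b₁ * b₂ * (b₃ * b₄), k, ?_, by simp [hb₁, hb₂, hb₃, hb₄], ?_, ?_,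
    C (b₁ * b₂) * C b₄ * u', C (b₁ * b₂) * C b₃ * v', hinj ?_⟩
  · rintro rfl
    simp only [Polynomial.map_zero] at hassoc
    exact UniqueFactorizationMonoid.radical_ne_zero ((associated_zero_iff_eq_zero _).1 hassoc)
  · refine h1.trans ⟨C (b₂ * (b₃ * b₄)), ?_⟩
    simp only [C_mul]; ring
  · refine h2.trans ⟨C (b₁ * (b₃ * b₄)), ?_⟩
    simp only [C_mul]; ring
  · simp only [Polynomial.map_add, Polynomial.map_mul, hu, hv, map_C, map_mul]
    rw [← Polynomial.derivative_map]
    linear_combination (C (algebraMap A K b₁) * C (algebraMap A K b₂) * C (algebraMap A K b₃) *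
      C (algebraMap A K b₄)) * huv

/-- The evaluation of a polynomial with polynomial coefficients is jointly continuous. -/
theorem continuous_eval₂_mvPolynomial {σ : Type*} (g : Polynomial (MvPolynomial σ ℝ)) :
    Continuous fun p : (σ → ℝ) × ℝ => g.eval₂ (MvPolynomial.eval p.1) p.2 := by
  simp only [Polynomial.eval₂_eq_sum_range]
  refine continuous_finsetSum _ fun i _ => ?_
  exact ((MvPolynomial.continuous_eval _).comp continuous_fst).mul (continuous_snd.pow i)

/-- Zeros of a polynomial are locally bounded where its leading coefficient does not vanish. -/
theorem eventually_eval₂_ne_zero_of_le_abs {σ : Type*} (g : Polynomial (MvPolynomial σ ℝ))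
    {y₀ : σ → ℝ} (h : MvPolynomial.eval y₀ g.leadingCoeff ≠ 0) :
    ∃ R : ℝ, ∀ᶠ y in 𝓝 y₀, ∀ s, R ≤ |s| → g.eval₂ (MvPolynomial.eval y) s ≠ 0 := by
  have h0 : g.reverse.eval₂ (MvPolynomial.eval y₀) 0 ≠ 0 := by
    rwa [Polynomial.eval₂_at_zero, Polynomial.coeff_zero_reverse]
  have hnear := (continuous_eval₂_mvPolynomial g.reverse).continuousAt.eventually_ne
    (x := (y₀, (0 : ℝ))) h0
  rw [nhds_prod_eq] at hnear
  obtain ⟨pB, hpB, pI, hpI, hBI⟩ := Filter.eventually_prod_iff.1 hnear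
  obtain ⟨ε, hε, hball⟩ := Metric.eventually_nhds_iff.1 hpI
  refine ⟨2 / ε, hpB.mono fun y hy s hs => ?_⟩
  have hspos : 0 < |s| := lt_of_lt_of_le (by positivity) hs
  have hs0 : s ≠ 0 := abs_pos.1 hspos
  let _ : Invertible s := invertibleOfNonzero hs0
  rw [← Polynomial.eval₂_reverse_mul_pow]
  refine mul_ne_zero (hBI hy (hball ?_)) (pow_ne_zero _ hs0)
  rw [dist_zero_right, invOf_eq_inv, norm_inv, Real.norm_eq_abs, inv_lt_comm₀ hspos hε]
  refine lt_of_lt_of_le ?_ hs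
  rw [inv_eq_one_div]
  gcongr
  norm_num

/-- A nonzero polynomial takes nonzero values arbitrarily close to any point along the segment to
a point where it does not vanish. -/
theorem eventually_eval_lineMap_ne_zero {σ : Type*} (f : MvPolynomial σ ℝ) (x : σ → ℝ)
    {y : σ → ℝ} (hy : MvPolynomial.eval y f ≠ 0) :
    ∀ᶠ t in 𝓝[>] (0 : ℝ), MvPolynomial.eval (fun i => x i + t * (y i - x i)) f ≠ 0 := by
  let q : Polynomial ℝ := MvPolynomial.aeval
    (fun i => Polynomial.C (x i) + Polynomial.X * Polynomial.C (y i - x i)) f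
  have hq : ∀ t, q.eval t = MvPolynomial.eval (fun i => x i + t * (y i - x i)) f := by
    intro t
    simp only [q]
    rw [← Polynomial.coe_evalRingHom, MvPolynomial.aeval_def, MvPolynomial.hom_eval₂]
    rw [MvPolynomial.eval, MvPolynomial.coe_eval₂Hom]
    congr 1
    · ext; simp
    · ext; simp
  have hq0 : q ≠ 0 := by
    rintro h0
    have := hq 1
    simp [h0] at this
    exact hy this.symm
  have hfin : {t | q.IsRoot t}.Finite := Polynomial.finite_setOfPred_isRoot hq0
  have : ∀ᶠ t in 𝓝[>] (0 : ℝ), t ∉ {t | q.IsRoot t} \ {0} :=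
    nhdsWithin_le_nhds ((hfin.subset sdiff_subset).isClosed.isOpen_compl.mem_nhds (by simp))
  filter_upwards [this, self_mem_nhdsWithin] with t ht ht0
  rw [← hq]
  exact fun h => ht ⟨h, (ne_of_gt ht0)⟩

theorem exists_eval_ne_zero {σ : Type*} {f : MvPolynomial σ ℝ} (hf : f ≠ 0) :
    ∃ x, MvPolynomial.eval x f ≠ 0 := by
  by_contra! h
  exact hf (MvPolynomial.funext (by simpa using h))

/-- It suffices to count path classes off a larger hypersurface. -/
theorem FinitelyManyPathClasses.of_mul {σ : Type*} [Finite σ] {f h : MvPolynomial σ ℝ}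
    (hfh : f * h ≠ 0)
    (H : FinitelyManyPathClasses {x | MvPolynomial.eval x (f * h) ≠ 0}) :
    FinitelyManyPathClasses {x | MvPolynomial.eval x f ≠ 0} := by
  refine H.of_reachable (fun x hx => ?_) fun x hx => ?_
  · rw [mem_ofPred_eq, map_mul] at hx
    exact left_ne_zero_of_mul hx
  · obtain ⟨y, hy⟩ := exists_eval_ne_zero hfh
    have hopen : ∀ᶠ t in 𝓝[>] (0 : ℝ), ∀ s ∈ Icc 0 t,
        MvPolynomial.eval (fun i => x i + s * (y i - x i)) f ≠ 0 := by
      have hc : Continuous fun s : ℝ => MvPolynomial.eval (fun i => x i + s * (y i - x i)) f :=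
        (MvPolynomial.continuous_eval f).comp (by fun_prop)
      have hne : ∀ᶠ s in 𝓝 (0 : ℝ),
          MvPolynomial.eval (fun i => x i + s * (y i - x i)) f ≠ 0 :=
        hc.continuousAt.eventually_ne (by simpa using hx)
      obtain ⟨ε, hε, hball⟩ := Metric.eventually_nhds_iff.1 hne
      filter_upwards [Ioo_mem_nhdsGT hε] with t ht s hs
      exact hball (by rw [Real.dist_eq, sub_zero, abs_of_nonneg hs.1]; exact hs.2.trans_lt ht.2)
    obtain ⟨t, ht1, ht2, ht0⟩ := (hopen.and ((eventually_eval_lineMap_ne_zero (f * h) x hy).and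
      self_mem_nhdsWithin)).exists
    refine ⟨_, ht2, ?_⟩
    have := JoinedIn.image_of_continuous (S := Icc 0 t) (T := {x | MvPolynomial.eval x f ≠ 0})
      (JoinedIn.of_segment_subset (segment_eq_Icc (le_of_lt ht0)).subset)
      (φ := fun s i => x i + s * (y i - x i)) (by fun_prop) (fun s hs => ht1 s hs)
    simpa using this

/-- The complement of a real algebraic hypersurface has finitely many path classes. -/
theorem finitelyManyPathClasses_eval_ne_zero_fin : ∀ {N : ℕ} {f : MvPolynomial (Fin N) ℝ},
    f ≠ 0 → FinitelyManyPathClasses {x | MvPolynomial.eval x f ≠ 0} := by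
  intro N
  induction N with
  | zero =>
    intro f _
    exact ⟨{0}, finite_singleton 0, fun x hx => ⟨0, rfl, by
      rw [Subsingleton.elim 0 x]; exact JoinedIn.refl hx⟩⟩
  | succ N ih =>
    intro f hf
    obtain ⟨g, δ₀, k, hg, hδ₀, ⟨c, hc⟩, ⟨d, hd⟩, a, b, hab⟩ :=
      exists_generic_squarefree_part (f := MvPolynomial.finSuccEquiv ℝ N f) (by simpa using hf)
    set δ := δ₀ * g.leadingCoeff with hδdef
    have hδ : δ ≠ 0 := mul_ne_zero hδ₀ (by simpa using hg)
    have hδr : MvPolynomial.rename Fin.succ δ ≠ 0 := by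
      rwa [Ne, MvPolynomial.rename_eq_zero_iff_of_injective _ (Fin.succ_injective N)]
    refine FinitelyManyPathClasses.of_mul (h := MvPolynomial.rename Fin.succ δ)
      (mul_ne_zero hf hδr) ?_
    let φ : (Fin N → ℝ) → ℝ → ℝ := fun y s => g.eval₂ (MvPolynomial.eval y) s
    let U : Set (Fin N → ℝ) := {y | MvPolynomial.eval y δ ≠ 0}
    set W : Set (Fin (N + 1) → ℝ) :=
      {x | MvPolynomial.eval x (f * MvPolynomial.rename Fin.succ δ) ≠ 0} with hW
    have hU0 : ∀ y ∈ U, MvPolynomial.eval y δ₀ ≠ 0 := fun y hy => by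
      simp only [U, mem_ofPred_eq, hδdef, map_mul] at hy
      exact left_ne_zero_of_mul hy
    have hcons : ∀ y s, MvPolynomial.eval (Fin.cons s y : Fin (N + 1) → ℝ) f =
        (MvPolynomial.finSuccEquiv ℝ N f).eval₂ (MvPolynomial.eval y) s := fun y s => by
      rw [MvPolynomial.eval_eq_eval_mv_eval', Polynomial.eval_map]
    have hzero : ∀ y ∈ U, ∀ s, MvPolynomial.eval (Fin.cons s y : Fin (N + 1) → ℝ) f = 0 ↔
        φ y s = 0 := by
      intro y hy s
      have hc' := congrArg (Polynomial.eval₂ (MvPolynomial.eval y) s) hc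
      have hd' := congrArg (Polynomial.eval₂ (MvPolynomial.eval y) s) hd
      simp only [Polynomial.eval₂_mul, Polynomial.eval₂_C, Polynomial.eval₂_pow, ← hcons]
        at hc' hd'
      constructor
      · intro h
        rw [h, zero_mul] at hd'
        exact eq_zero_of_pow_eq_zero ((mul_eq_zero.1 hd').resolve_left (hU0 y hy))
      · intro h
        simp only [φ] at h
        rw [h, zero_mul] at hc'
        exact (mul_eq_zero.1 hc').resolve_left (hU0 y hy)
    have hmem : ∀ y s, (Fin.cons s y : Fin (N + 1) → ℝ) ∈ W ↔ y ∈ U ∧ φ y s ≠ 0 := by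
      intro y s
      have hr : MvPolynomial.eval (Fin.cons s y : Fin (N + 1) → ℝ)
          (MvPolynomial.rename Fin.succ δ) = MvPolynomial.eval y δ := by
        rw [MvPolynomial.eval_rename]
        congr 1
      rw [hW, mem_ofPred_eq, map_mul, hr, mul_ne_zero_iff, and_comm]
      exact and_congr_right fun hy => not_congr (hzero y hy s)
    have hpath : ∀ y, ∀ s s', (∀ r ∈ uIcc s s', (Fin.cons r y : Fin (N + 1) → ℝ) ∈ W) →
        JoinedIn W (Fin.cons s y : Fin (N + 1) → ℝ) (Fin.cons s' y) := by
      intro y s s' h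
      refine JoinedIn.image_of_continuous (S := uIcc s s')
        (JoinedIn.of_segment_subset (segment_eq_uIcc s s').subset)
        (φ := fun r => (Fin.cons r y : Fin (N + 1) → ℝ)) (by fun_prop) fun r hr => h r hr
    have hUopen : IsOpen U :=
      (MvPolynomial.continuous_eval δ).isOpen_preimage _ isOpen_compl_singleton
    have hlocal : ∀ z ∈ U, ∀ᶠ y in 𝓝 z, ∀ s, (Fin.cons s y : Fin (N + 1) → ℝ) ∈ W →
        ∃ s', JoinedIn W (Fin.cons s y : Fin (N + 1) → ℝ) (Fin.cons s' z) := by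
      intro z hz
      obtain ⟨R, hR⟩ := eventually_eval₂_ne_zero_of_le_abs g (y₀ := z) (by
        simp only [U, mem_ofPred_eq, hδdef, map_mul] at hz
        exact right_ne_zero_of_mul hz)
      obtain ⟨B, hB, h⟩ := eventually_exists_uIcc_ne_zero (φ := φ)
        (ψ := fun y s => g.derivative.eval₂ (MvPolynomial.eval y) s)
        (continuous_eval₂_mvPolynomial g) (continuous_eval₂_mvPolynomial _)
        (fun y s => by
          simpa only [φ, Polynomial.eval_map, Polynomial.derivative_map] using
            (g.map (MvPolynomial.eval y)).hasDerivAt s)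
        (fun s hs hs' => by
          have := congrArg (Polynomial.eval₂ (MvPolynomial.eval z) s) hab
          simp only [Polynomial.eval₂_add, Polynomial.eval₂_mul, Polynomial.eval₂_C, hs'] at this
          simp only [φ] at hs
          rw [hs, mul_zero, mul_zero, add_zero] at this
          exact hU0 z hz this.symm) hR
      obtain ⟨ε, hε, hball⟩ := Metric.mem_nhds_iff.1 (Filter.inter_mem hB (hUopen.mem_nhds hz))
      filter_upwards [Metric.ball_mem_nhds z hε] with y hy s hs
      obtain ⟨s', h1, h2⟩ := h y (hball hy).1 s ((hmem y s).1 hs).2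
      refine ⟨s', (hpath y s s' fun r hr => (hmem y r).2 ⟨(hball hy).2, h1 r hr⟩).trans ?_⟩
      refine JoinedIn.image_of_continuous (S := Metric.ball z ε)
        (JoinedIn.of_segment_subset ((convex_ball z ε).segment_subset hy
          (Metric.mem_ball_self hε)))
        (φ := fun y => (Fin.cons s' y : Fin (N + 1) → ℝ)) (by fun_prop) fun w hw => ?_
      exact (hmem w s').2 ⟨(hball hw).2, h2 w (hball hw).1⟩
    obtain ⟨F, hF, hFU⟩ := ih hδ
    have hfib : ∀ y, ∃ G : Set ℝ, G.Finite ∧ (y ∈ U → ∀ s, φ y s ≠ 0 → ∃ s' ∈ G,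
        JoinedIn W (Fin.cons s y : Fin (N + 1) → ℝ) (Fin.cons s' y)) := by
      intro y
      by_cases hy : y ∈ U
      · have hgy : g.map (MvPolynomial.eval y) ≠ 0 := fun h0 => by
          have := congrArg (Polynomial.coeff · g.natDegree) h0
          simp only [Polynomial.coeff_map, Polynomial.coeff_natDegree, Polynomial.coeff_zero]
            at this
          simp only [U, mem_ofPred_eq, hδdef, map_mul] at hy
          exact right_ne_zero_of_mul hy this
        obtain ⟨G, hG, h⟩ :=
          (Polynomial.finite_setOfPred_isRoot hgy).finitelyManyPathClasses_compl
        refine ⟨G, hG, fun _ s hs => ?_⟩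
        have hiff : ∀ r, r ∈ {x | (g.map (MvPolynomial.eval y)).IsRoot x}ᶜ ↔ φ y r ≠ 0 :=
          fun r => by simp [φ, Polynomial.IsRoot, Polynomial.eval_map]
        obtain ⟨s', hs', hj⟩ := h s ((hiff s).2 hs)
        exact ⟨s', hs', hj.image_of_continuous
          (φ := fun r => (Fin.cons r y : Fin (N + 1) → ℝ)) (by fun_prop)
          fun r hr => (hmem y r).2 ⟨hy, (hiff r).1 hr⟩⟩
      · exact ⟨∅, finite_empty, fun h => absurd h hy⟩
    choose G hG hGW using hfib
    refine ⟨⋃ y ∈ F, (fun s => (Fin.cons s y : Fin (N + 1) → ℝ)) '' G y,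
      hF.biUnion fun y _ => (hG y).image _, fun x hx => ?_⟩
    obtain ⟨s, y, rfl⟩ : ∃ s y, x = Fin.cons s y := ⟨x 0, Fin.tail x, (Fin.cons_self_tail x).symm⟩
    obtain ⟨z, hz, hyz⟩ := hFU y ((hmem y s).1 hx).1
    obtain ⟨s₁, hs₁⟩ := hyz.of_locally_iff
      (T := fun z => ∃ s', JoinedIn W (Fin.cons s y : Fin (N + 1) → ℝ) (Fin.cons s' z)) (by
        intro w hw
        have hback : ∀ᶠ v in 𝓝 w, (∃ s', JoinedIn W (Fin.cons s y : Fin (N + 1) → ℝ)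
            (Fin.cons s' w)) → v ∈ U → ∃ s', JoinedIn W (Fin.cons s y : Fin (N + 1) → ℝ)
            (Fin.cons s' v) := by
          by_cases hw' : ∃ s', JoinedIn W (Fin.cons s y : Fin (N + 1) → ℝ) (Fin.cons s' w)
          · obtain ⟨s', hs'⟩ := hw'
            have hWopen : IsOpen W :=
              (MvPolynomial.continuous_eval _).isOpen_preimage _ isOpen_compl_singleton
            have hc : Continuous fun v => (Fin.cons s' v : Fin (N + 1) → ℝ) := by fun_prop
            obtain ⟨ε, hε, hball⟩ := Metric.mem_nhds_iff.1
              (hc.continuousAt.preimage_mem_nhds (hWopen.mem_nhds hs'.target_mem))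
            filter_upwards [Metric.ball_mem_nhds w hε] with v hv _ _
            refine ⟨s', hs'.trans ?_⟩
            exact JoinedIn.image_of_continuous (S := Metric.ball w ε)
              (JoinedIn.of_segment_subset ((convex_ball w ε).segment_subset
                (Metric.mem_ball_self hε) hv)) hc hball
          · exact Filter.Eventually.of_forall fun v h => absurd h hw'
        filter_upwards [hlocal w hw, hback] with v hv hv' hvU
        refine ⟨?_, fun h => hv' h hvU⟩
        rintro ⟨s', hs'⟩
        obtain ⟨s'', hs''⟩ := hv s' hs'.target_mem
        exact ⟨s'', hs'.trans hs''⟩)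
      ⟨s, JoinedIn.refl hx⟩
    obtain ⟨hzU, hne⟩ := (hmem z s₁).1 hs₁.target_mem
    obtain ⟨s₂, hs₂, hj⟩ := hGW z hzU s₁ hne
    exact ⟨_, mem_biUnion hz (mem_image_of_mem _ hs₂), hs₁.trans hj⟩

/-- The complement of a real algebraic hypersurface has finitely many path classes. -/
theorem finitelyManyPathClasses_eval_ne_zero {σ : Type*} [Finite σ] {f : MvPolynomial σ ℝ}
    (hf : f ≠ 0) : FinitelyManyPathClasses {x | MvPolynomial.eval x f ≠ 0} := by
  obtain ⟨N, ⟨e⟩⟩ := Finite.exists_equiv_fin σ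
  have hf' : MvPolynomial.rename e f ≠ 0 := by
    rwa [Ne, MvPolynomial.rename_eq_zero_iff_of_injective _ e.injective]
  have h := (finitelyManyPathClasses_eval_ne_zero_fin hf').image
    (φ := fun (x : Fin N → ℝ) i => x (e i)) (by fun_prop)
  convert h using 1
  ext x
  simp only [MvPolynomial.eval_rename, mem_image, mem_ofPred_eq]
  constructor
  · intro hx
    refine ⟨x ∘ e.symm, ?_, ?_⟩
    · rwa [Function.comp_assoc, Equiv.symm_comp_self, Function.comp_id]
    · ext i; simp
  · rintro ⟨y, hy, rfl⟩
    exact hy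

/-- The value at a placement `x` of a formal affine combination of nodes: the first component
records the coefficients of the nodes and the second one a constant vector. -/
noncomputable def placementEval {ι κ : Type*} [Fintype ι] (x : ι → κ → ℝ) :
    (ι → ℝ) × (κ → ℝ) →ₗ[ℝ] (κ → ℝ) :=
  (Fintype.linearCombination ℝ x).coprod LinearMap.id

theorem placementEval_apply {ι κ : Type*} [Fintype ι] (x : ι → κ → ℝ) (v : (ι → ℝ) × (κ → ℝ)) :
    placementEval x v = ∑ u, v.1 u • x u + v.2 := by
  simp [placementEval, Fintype.linearCombination_apply]

/-- A space of formal combinations of dimension at most that of the ambient space is evaluated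
injectively at some placement. -/
theorem exists_disjoint_ker_placementEval {ι κ : Type*} [Fintype ι] [Fintype κ]
    (V : Submodule ℝ ((ι → ℝ) × (κ → ℝ))) (hV : Module.finrank ℝ V ≤ Fintype.card κ) :
    ∃ x : ι → κ → ℝ, V ⊓ LinearMap.ker (placementEval x) = ⊥ := by
  classical
  have step : ∀ (k : ℕ) (x : ι → κ → ℝ),
      Module.finrank ℝ ↥(V ⊓ LinearMap.ker (placementEval x)) = k →
      ∃ x : ι → κ → ℝ, V ⊓ LinearMap.ker (placementEval x) = ⊥ := by
    intro k
    induction k using Nat.strong_induction_on with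
    | _ k ih =>
      intro x hx
      by_cases hbot : V ⊓ LinearMap.ker (placementEval x) = ⊥
      · exact ⟨x, hbot⟩
      obtain ⟨v, ⟨hvV, hvx⟩, hv0⟩ := Submodule.exists_mem_ne_zero_of_ne_bot hbot
      have hvx' : placementEval x v = 0 := hvx
      have hlt : Module.finrank ℝ (LinearMap.range ((placementEval x).domRestrict V)) <
          Module.finrank ℝ (κ → ℝ) := by
        have hrank := LinearMap.finrank_range_add_finrank_ker ((placementEval x).domRestrict V)
        have hpos : 0 < Module.finrank ℝ (LinearMap.ker ((placementEval x).domRestrict V)) := by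
          have hmem : (⟨v, hvV⟩ : V) ∈ LinearMap.ker ((placementEval x).domRestrict V) := hvx'
          refine Submodule.one_le_finrank_iff.2 fun h => hv0 ?_
          rw [h, Submodule.mem_bot] at hmem
          exact congrArg Subtype.val hmem
        rw [Module.finrank_fintype_fun_eq_card]
        omega
      obtain ⟨y, hy⟩ : ∃ y, y ∉ LinearMap.range ((placementEval x).domRestrict V) := by
        by_contra! h
        rw [(Submodule.eq_top_iff').2 h, finrank_top] at hlt
        exact lt_irrefl _ hlt
      obtain ⟨i, hi⟩ : ∃ i, v.1 i ≠ 0 := by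
        by_contra! h
        have h1 : v.1 = 0 := funext h
        rw [placementEval_apply] at hvx'
        simp only [h, zero_smul, Finset.sum_const_zero, zero_add] at hvx'
        exact hv0 (Prod.ext h1 hvx')
      have heval : ∀ w, placementEval (Function.update x i (x i + y)) w =
          placementEval x w + w.1 i • y := by
        intro w
        simp only [placementEval_apply]
        have : ∀ u, w.1 u • Function.update x i (x i + y) u =
            w.1 u • x u + if u = i then w.1 i • y else 0 := by
          intro u
          by_cases hu : u = i
          · subst hu; simp
          · simp [hu]
        simp only [this, Finset.sum_add_distrib, Finset.sum_ite_eq', Finset.mem_univ, if_true]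
        abel
      have hker : ∀ w ∈ V ⊓ LinearMap.ker (placementEval (Function.update x i (x i + y))),
          w.1 i = 0 ∧ placementEval x w = 0 := by
        rintro w ⟨hwV, hw⟩
        have hw' : placementEval x w + w.1 i • y = 0 := (heval w).symm.trans hw
        have hwi : w.1 i = 0 := by
          by_contra hne
          refine hy ⟨-(w.1 i)⁻¹ • ⟨w, hwV⟩, ?_⟩
          rw [map_smul, LinearMap.domRestrict_apply, eq_neg_of_add_eq_zero_left hw', smul_neg,
            neg_smul, neg_neg, smul_smul, inv_mul_cancel₀ hne, one_smul]
        exact ⟨hwi, by simpa [hwi] using hw'⟩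
      refine ih _ ?_ (Function.update x i (x i + y)) rfl
      rw [← hx]
      refine Submodule.finrank_lt_finrank_of_lt (lt_of_le_of_ne (fun w hw => ?_) fun heq => ?_)
      · exact ⟨hw.1, (hker w hw).2⟩
      · have hmem : v ∈ V ⊓ LinearMap.ker (placementEval (Function.update x i (x i + y))) := by
          rw [heq]; exact ⟨hvV, hvx⟩
        exact hi (hker v hmem).1
  exact step _ 0 rfl

/-- The failure of injectivity on a low-dimensional space of formal combinations is confined to a
proper algebraic set of placements. -/
theorem exists_mvPolynomial_disjoint_ker {ι κ : Type*} [Fintype ι] [Fintype κ]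
    (V : Submodule ℝ ((ι → ℝ) × (κ → ℝ))) (hV : Module.finrank ℝ V ≤ Fintype.card κ) :
    ∃ f : MvPolynomial (ι × κ) ℝ, f ≠ 0 ∧ ∀ x : ι → κ → ℝ,
      MvPolynomial.eval (fun p => x p.1 p.2) f ≠ 0 →
        ∀ v ∈ V, placementEval x v = 0 → v = 0 := by
  classical
  obtain ⟨x₀, hx₀⟩ := exists_disjoint_ker_placementEval V hV
  have hinj : LinearMap.ker ((placementEval x₀).domRestrict V) = ⊥ := by
    rw [LinearMap.ker_eq_bot']
    intro v hv
    have : (v : (ι → ℝ) × (κ → ℝ)) ∈ V ⊓ LinearMap.ker (placementEval x₀) := ⟨v.2, hv⟩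
    rw [hx₀] at this
    exact Subtype.ext ((Submodule.mem_bot ℝ).1 this)
  obtain ⟨l, hl⟩ := LinearMap.exists_leftInverse_of_injective _ hinj
  let b := Module.finBasis ℝ V
  let T : (ι → κ → ℝ) → V →ₗ[ℝ] V := fun x => l ∘ₗ (placementEval x).domRestrict V
  let M : Matrix (Fin (Module.finrank ℝ V)) (Fin (Module.finrank ℝ V))
      (MvPolynomial (ι × κ) ℝ) := fun i j =>
    ∑ u, ∑ k, MvPolynomial.C ((b j : (ι → ℝ) × (κ → ℝ)).1 u * b.repr (l (Pi.single k 1)) i) *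
      MvPolynomial.X (u, k) + MvPolynomial.C (b.repr (l (b j : (ι → ℝ) × (κ → ℝ)).2) i)
  have hM : ∀ x : ι → κ → ℝ, MvPolynomial.eval (fun p : ι × κ => x p.1 p.2) M.det =
      LinearMap.det (T x) := by
    intro x
    rw [RingHom.map_det, ← LinearMap.det_toMatrix b]
    refine congrArg Matrix.det (Matrix.ext fun i j => ?_)
    have hlin : ∀ c : κ → ℝ, b.repr (l c) i = ∑ k, c k * b.repr (l (Pi.single k 1)) i := by
      intro c
      conv_lhs => rw [← Finset.univ_sum_single c]
      simp only [map_sum, Finsupp.coe_finsetSum, Finset.sum_apply]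
      refine Finset.sum_congr rfl fun k _ => ?_
      have : (Pi.single k (c k) : κ → ℝ) = c k • Pi.single k 1 := by
        rw [← Pi.single_smul, smul_eq_mul, mul_one]
      rw [this, map_smul, map_smul, Finsupp.smul_apply, smul_eq_mul]
    change MvPolynomial.eval _ (M i j) = _
    simp only [M, LinearMap.toMatrix_apply, T,
      LinearMap.comp_apply, LinearMap.domRestrict_apply, placementEval_apply, map_add, map_sum,
      map_mul, MvPolynomial.eval_C, MvPolynomial.eval_X, map_smul, Finsupp.coe_add, Pi.add_apply,
      Finsupp.coe_finsetSum, Finset.sum_apply, Finsupp.smul_apply, smul_eq_mul]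
    congr 1
    refine Finset.sum_congr rfl fun u _ => ?_
    rw [hlin (x u), Finset.mul_sum]
    refine Finset.sum_congr rfl fun k _ => ?_
    ring
  refine ⟨M.det, fun h0 => ?_, fun x hx v hv hvx => ?_⟩
  · have := hM x₀
    rw [h0, map_zero] at this
    simp only [T, hl, LinearMap.det_id] at this
    exact zero_ne_one this
  · rw [hM] at hx
    have hT : T x ⟨v, hv⟩ = 0 := by
      simp [T, hvx]
    have := (LinearEquiv.ofIsUnitDet (v := b) (v' := b) (f := T x) (by
      rw [LinearMap.det_toMatrix]; exact isUnit_iff_ne_zero.2 hx)).map_eq_zero_iff.1 hT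
    exact congrArg Subtype.val this

/-- Finitely many low-dimensional spaces of formal combinations are simultaneously evaluated
injectively off a proper algebraic set of placements. -/
theorem exists_mvPolynomial_forall_disjoint_ker {ι κ : Type*} [Fintype ι] [Fintype κ]
    {S : Set (Submodule ℝ ((ι → ℝ) × (κ → ℝ)))} (hS : S.Finite)
    (hV : ∀ V ∈ S, Module.finrank ℝ V ≤ Fintype.card κ) :
    ∃ f : MvPolynomial (ι × κ) ℝ, f ≠ 0 ∧ ∀ x : ι → κ → ℝ,
      MvPolynomial.eval (fun p => x p.1 p.2) f ≠ 0 →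
        ∀ V ∈ S, ∀ v ∈ V, placementEval x v = 0 → v = 0 := by
  induction S, hS using Set.Finite.induction_on with
  | empty => exact ⟨1, one_ne_zero, by simp⟩
  | insert _ _ ih =>
    obtain ⟨f, hf, h⟩ := ih fun V hVS => hV V (mem_insert_of_mem _ hVS)
    obtain ⟨g, hg, h'⟩ := exists_mvPolynomial_disjoint_ker _ (hV _ (mem_insert _ _))
    refine ⟨f * g, mul_ne_zero hf hg, fun x hx V hVS => ?_⟩
    rw [map_mul, mul_ne_zero_iff] at hx
    rcases hVS with rfl | hVS
    · exact h' x hx.2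
    · exact h x hx.1 V hVS

/-- A nondegenerate segment determines its endpoints up to order. -/
theorem segment_eq_segment_imp {E : Type*} [AddCommGroup E] [Module ℝ E] {a b c d : E}
    (hcd : c ≠ d) (h : segment ℝ a b = segment ℝ c d) :
    (a = c ∧ b = d) ∨ (a = d ∧ b = c) := by
  have ha : a ∈ segment ℝ c d := h ▸ left_mem_segment ℝ a b
  have hb : b ∈ segment ℝ c d := h ▸ right_mem_segment ℝ a b
  have hc : c ∈ segment ℝ a b := h ▸ left_mem_segment ℝ c d
  have hd : d ∈ segment ℝ a b := h ▸ right_mem_segment ℝ c d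
  rw [segment_eq_image'] at ha hb hc hd
  obtain ⟨s, ⟨hs0, hs1⟩, hs⟩ := ha
  obtain ⟨t, ⟨ht0, ht1⟩, ht⟩ := hb
  obtain ⟨p, ⟨hp0, hp1⟩, hp⟩ := hc
  obtain ⟨q, ⟨hq0, hq1⟩, hq⟩ := hd
  simp only at hs ht hp hq
  have hmul : ((q - p) * (t - s) - 1) • (d - c) = 0 := by
    have h1 : d - c = (q - p) • (b - a) := by
      conv_lhs => rw [← hq, ← hp]
      module
    have h2 : b - a = (t - s) • (d - c) := by
      conv_lhs => rw [← ht, ← hs]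
      module
    rw [sub_smul, mul_smul, ← h2, ← h1, one_smul, sub_self]
  have hone : (q - p) * (t - s) = 1 := by
    rcases smul_eq_zero.1 hmul with h0 | h0
    · linarith
    · exact absurd (sub_eq_zero.1 h0).symm hcd
  rcases le_total s t with hst | hst
  · have hs' : s = 0 := by nlinarith
    have ht' : t = 1 := by nlinarith
    left
    subst hs' ht'
    simpa [eq_comm] using And.intro hs ht
  · have hs' : s = 1 := by nlinarith
    have ht' : t = 0 := by nlinarith
    right
    subst hs' ht'
    simpa [eq_comm] using And.intro hs ht

theorem intVec_add (m m' : Fin 3 → ℤ) : intVec (m + m') = intVec m + intVec m' := by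
  ext i; simp [intVec]

theorem intVec_sub (m m' : Fin 3 → ℤ) : intVec (m - m') = intVec m - intVec m' := by
  ext i; simp [intVec]

theorem intVec_zero : intVec 0 = 0 := by
  ext i; simp [intVec]

theorem intVec_injective : Function.Injective intVec := fun m m' h => by
  ext i
  exact Int.cast_injective (α := ℝ) (congrFun h i)

/-- The formal combination representing the translate by `m` of the node `u`. -/
noncomputable def formalNode {n : ℕ} (u : Fin n) (m : Fin 3 → ℤ) :
    (Fin n → ℝ) × (Fin 3 → ℝ) :=
  (Pi.single u 1, intVec m)

theorem placementEval_formalNode {n : ℕ} (x : Fin n → Fin 3 → ℝ) (u : Fin n) (m : Fin 3 → ℤ) :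
    placementEval x (formalNode u m) = x u + intVec m := by
  simp [placementEval_apply, formalNode, Pi.single_apply, ite_smul]

theorem formalNode_injective {n : ℕ} {u u' : Fin n} {m m' : Fin 3 → ℤ}
    (h : formalNode u m = formalNode u' m') : u = u' ∧ m = m' := by
  obtain ⟨h1, h2⟩ := Prod.mk.inj h
  refine ⟨?_, intVec_injective h2⟩
  by_contra hne
  have := congrFun h1 u
  simp [hne] at this

/-- The formal directions spanned by two nodes, the second translated by `m`. -/
noncomputable def nodePairSpan {n : ℕ} (u u' : Fin n) (m : Fin 3 → ℤ) :
    Submodule ℝ ((Fin n → ℝ) × (Fin 3 → ℝ)) :=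
  Submodule.span ℝ (range ![formalNode u' m - formalNode u 0])

/-- The formal directions spanned by the endpoints of two edges, the second translated by `m`. -/
noncomputable def edgePairSpan {n : ℕ} (e e' : Fin n × Fin n × (Fin 3 → ℤ)) (m : Fin 3 → ℤ) :
    Submodule ℝ ((Fin n → ℝ) × (Fin 3 → ℝ)) :=
  Submodule.span ℝ (range ![formalNode e.2.1 e.2.2 - formalNode e.1 0,
    formalNode e'.2.1 e'.2.2 - formalNode e'.1 0, formalNode e'.1 m - formalNode e.1 0])

theorem eq_zero_or_eq_one_of_segment_point {V : Type*} [AddCommGroup V] [Module ℝ V] {a b : V}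
    (hab : a ≠ b) {s : ℝ} (h : a + s • (b - a) = a ∨ a + s • (b - a) = b) : s = 0 ∨ s = 1 := by
  have hba : b - a ≠ 0 := sub_ne_zero.2 hab.symm
  rcases h with h | h
  · left
    rw [add_eq_left] at h
    exact (smul_eq_zero.1 h).resolve_right hba
  · right
    have h' : (s - 1) • (b - a) = 0 := by
      rw [sub_smul, one_smul, sub_eq_zero]
      exact eq_sub_of_add_eq' h
    exact sub_eq_zero.1 ((smul_eq_zero.1 h').resolve_right hba)

/-- If the nodes of `x` are distinct and the affine dependencies between the endpoints of two
segments are all formal, then the two segments are in essentially disjoint position at `x`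
whenever they are so at a proper placement. -/
theorem ProperPlacement.endpoint_of_formal {n : ℕ} {E : Finset (Fin n × Fin n × (Fin 3 → ℤ))}
    {x₀ x : Fin n → Fin 3 → ℝ} (h₀ : ProperPlacement E x₀)
    {e e' : Fin n × Fin n × (Fin 3 → ℤ)} (he : e ∈ E) (he' : e' ∈ E) {m m' : Fin 3 → ℤ}
    (hformal : ∀ v ∈ edgePairSpan e e' (m' - m), placementEval x v = 0 → v = 0)
    (hne : segment ℝ (x e.1 + intVec m) (x e.2.1 + intVec e.2.2 + intVec m) ≠
        segment ℝ (x e'.1 + intVec m') (x e'.2.1 + intVec e'.2.2 + intVec m')) {s t : ℝ}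
    (hs : s ∈ Icc (0 : ℝ) 1) (ht : t ∈ Icc (0 : ℝ) 1)
    (hst : x e.1 + intVec m + s • (x e.2.1 + intVec e.2.2 + intVec m - (x e.1 + intVec m)) =
      x e'.1 + intVec m' + t • (x e'.2.1 + intVec e'.2.2 + intVec m' - (x e'.1 + intVec m'))) :
    (s = 0 ∨ s = 1) ∧ (t = 0 ∨ t = 1) := by
  have hrel : ∀ y : Fin n → Fin 3 → ℝ,
      placementEval y (s • (formalNode e.2.1 e.2.2 - formalNode e.1 0) -
        t • (formalNode e'.2.1 e'.2.2 - formalNode e'.1 0) -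
        (formalNode e'.1 (m' - m) - formalNode e.1 0)) =
      (y e.1 + intVec m + s • (y e.2.1 + intVec e.2.2 + intVec m - (y e.1 + intVec m))) -
      (y e'.1 + intVec m' + t • (y e'.2.1 + intVec e'.2.2 + intVec m' -
        (y e'.1 + intVec m'))) := by
    intro y
    simp only [map_sub, map_smul, placementEval_formalNode, intVec_sub, intVec_zero]
    module
  have hmem : s • (formalNode e.2.1 e.2.2 - formalNode e.1 0) -
      t • (formalNode e'.2.1 e'.2.2 - formalNode e'.1 0) -
      (formalNode e'.1 (m' - m) - formalNode e.1 0) ∈ edgePairSpan e e' (m' - m) :=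
    sub_mem (sub_mem (Submodule.smul_mem _ _ (Submodule.subset_span ⟨0, rfl⟩))
      (Submodule.smul_mem _ _ (Submodule.subset_span ⟨1, rfl⟩)))
      (Submodule.subset_span ⟨2, rfl⟩)
  have hzero := hformal _ hmem ((hrel x).trans (sub_eq_zero.2 hst))
  have hst₀ := sub_eq_zero.1 ((hrel x₀).symm.trans (by rw [hzero, map_zero]))
  obtain ⟨hnodes, hnondeg, hdisj⟩ := h₀
  have hd := hnondeg e he m
  have hd' := hnondeg e' he' m'
  by_cases hseg : segment ℝ (x₀ e.1 + intVec m) (x₀ e.2.1 + intVec e.2.2 + intVec m) =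
      segment ℝ (x₀ e'.1 + intVec m') (x₀ e'.2.1 + intVec e'.2.2 + intVec m')
  · refine absurd ?_ hne
    rcases segment_eq_segment_imp hd' hseg with ⟨h1, h2⟩ | ⟨h1, h2⟩
    · simp only [add_assoc, ← intVec_add] at h1 h2 ⊢
      obtain ⟨h1, h1'⟩ := hnodes _ _ _ _ h1
      obtain ⟨h2, h2'⟩ := hnodes _ _ _ _ h2
      rw [h1, h1', h2, ← h2', h1']
    · simp only [add_assoc, ← intVec_add] at h1 h2 ⊢
      obtain ⟨h1, h1'⟩ := hnodes _ _ _ _ h1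
      obtain ⟨h2, h2'⟩ := hnodes _ _ _ _ h2
      rw [h1, h2, ← h1', h2', segment_symm]
  · have hp := hdisj e he e' he' m m' hseg
      (x₀ e.1 + intVec m + s • (x₀ e.2.1 + intVec e.2.2 + intVec m - (x₀ e.1 + intVec m)))
      (by rw [segment_eq_image']; exact ⟨s, hs, rfl⟩)
      (by rw [segment_eq_image']; exact ⟨t, ht, hst₀.symm⟩)
    refine ⟨eq_zero_or_eq_one_of_segment_point hd hp.1,
      eq_zero_or_eq_one_of_segment_point hd' ?_⟩
    rw [← hst₀]
    exact hp.2

/-- If some placement is proper, then within any bounded region the improper placements are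
confined to a proper algebraic set. -/
theorem ProperPlacement.exists_mvPolynomial {n : ℕ} {E : Finset (Fin n × Fin n × (Fin 3 → ℤ))}
    {x₀ : Fin n → Fin 3 → ℝ} (h₀ : ProperPlacement E x₀) (R : ℝ) :
    ∃ f : MvPolynomial (Fin n × Fin 3) ℝ, f ≠ 0 ∧ ∀ x : Fin n → Fin 3 → ℝ,
      (∀ u i, |x u i| < R) → MvPolynomial.eval (fun p => x p.1 p.2) f ≠ 0 →
        ProperPlacement E x := by
  obtain ⟨K₀, hK₀⟩ : ∃ K₀ : ℝ, ∀ e ∈ E, ∀ i, |(e.2.2 i : ℝ)| ≤ K₀ := by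
    refine ⟨∑ e ∈ E, ∑ i, |(e.2.2 i : ℝ)|, fun e he i => ?_⟩
    refine (Finset.single_le_sum (f := fun i => |(e.2.2 i : ℝ)|) (fun i _ => abs_nonneg _)
      (Finset.mem_univ i)).trans ?_
    exact Finset.single_le_sum (f := fun e : Fin n × Fin n × (Fin 3 → ℤ) =>
      ∑ i, |(e.2.2 i : ℝ)|) (fun e _ => Finset.sum_nonneg fun i _ => abs_nonneg _) he
  obtain ⟨K, hK⟩ := exists_nat_ge (2 * R + 2 * |K₀|)
  let box : Set (Fin 3 → ℤ) := Icc (fun _ => -(K : ℤ)) (fun _ => (K : ℤ))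
  have hbox : box.Finite := finite_Icc _ _
  have hmem_box : ∀ m : Fin 3 → ℤ, (∀ i, |(m i : ℝ)| ≤ 2 * R + 2 * |K₀|) → m ∈ box := by
    intro m hm
    have hm' : ∀ i, -(K : ℤ) ≤ m i ∧ m i ≤ (K : ℤ) := fun i => by
      have := abs_le.1 ((hm i).trans hK)
      exact ⟨by exact_mod_cast this.1, by exact_mod_cast this.2⟩
    exact ⟨fun i => (hm' i).1, fun i => (hm' i).2⟩
  let S₁ : Set (Submodule ℝ ((Fin n → ℝ) × (Fin 3 → ℝ))) :=
    (fun q : (Fin n × Fin n) × (Fin 3 → ℤ) => nodePairSpan q.1.1 q.1.2 q.2) '' (univ ×ˢ box)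
  let S₂ : Set (Submodule ℝ ((Fin n → ℝ) × (Fin 3 → ℝ))) :=
    (fun q : ((Fin n × Fin n × (Fin 3 → ℤ)) × (Fin n × Fin n × (Fin 3 → ℤ))) × (Fin 3 → ℤ) =>
      edgePairSpan q.1.1 q.1.2 q.2) '' (((E : Set _) ×ˢ (E : Set _)) ×ˢ box)
  obtain ⟨f, hf, h⟩ := exists_mvPolynomial_forall_disjoint_ker (ι := Fin n) (κ := Fin 3)
    (S := S₁ ∪ S₂) (((finite_univ.prod hbox).image _).union
      (((E.finite_toSet.prod E.finite_toSet).prod hbox).image _)) (by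
      rintro _ (⟨q, -, rfl⟩ | ⟨q, -, rfl⟩)
      · exact (finrank_range_le_card _).trans (by simp)
      · exact (finrank_range_le_card _).trans (by simp))
  refine ⟨f, hf, fun x hxR hx => ?_⟩
  have hnodes : ∀ u u' : Fin n, ∀ m m' : Fin 3 → ℤ,
      x u + intVec m = x u' + intVec m' → u = u' ∧ m = m' := by
    intro u u' m m' heq
    have hb : m' - m ∈ box := by
      refine hmem_box _ fun i => ?_
      have := congrFun heq i
      simp only [Pi.add_apply, intVec] at this
      have h1 := abs_lt.1 (hxR u i)
      have h2 := abs_lt.1 (hxR u' i)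
      rw [Pi.sub_apply, Int.cast_sub, abs_le]
      constructor <;> linarith [abs_nonneg K₀]
    have := h x hx _ (Or.inl ⟨((u, u'), m' - m), ⟨mem_univ _, hb⟩, rfl⟩)
      (formalNode u' (m' - m) - formalNode u 0) (Submodule.subset_span ⟨0, rfl⟩) (by
        rw [map_sub, placementEval_formalNode, placementEval_formalNode, intVec_sub, intVec_zero,
          add_zero, ← add_sub_assoc, ← heq]
        abel)
    obtain ⟨hu, hm⟩ := formalNode_injective (sub_eq_zero.1 this)
    exact ⟨hu.symm, (sub_eq_zero.1 hm).symm⟩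
  refine ⟨hnodes, fun e he m heq => ?_, fun e he e' he' m m' hne p hp hp' => ?_⟩
  · rw [add_assoc, ← intVec_add] at heq
    obtain ⟨h1, h2⟩ := hnodes _ _ _ _ heq
    refine h₀.2.1 e he m ?_
    rw [add_assoc, ← intVec_add, ← h1, ← h2]
  · rw [segment_eq_image'] at hp hp'
    obtain ⟨s, hs, rfl⟩ := hp
    obtain ⟨t, ht, hst⟩ := hp'
    simp only at hst ⊢
    have hb : m' - m ∈ box := by
      refine hmem_box _ fun i => ?_
      have hi := congrFun hst i
      simp only [Pi.add_apply, Pi.smul_apply, Pi.sub_apply, smul_eq_mul, intVec] at hi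
      have hconv : ∀ (r a b : ℝ), r ∈ Icc (0 : ℝ) 1 → |a| < R → |b| < R →
          |a + r * (b - a)| ≤ R := by
        intro r a b hr ha hb
        rw [abs_lt] at ha hb
        rw [abs_le]
        constructor <;> nlinarith [hr.1, hr.2]
      have hlab : ∀ r k : ℝ, r ∈ Icc (0 : ℝ) 1 → |k| ≤ K₀ → |r * k| ≤ |K₀| := by
        intro r k hr hk
        rw [abs_mul, abs_of_nonneg hr.1]
        exact (mul_le_of_le_one_left (abs_nonneg k) hr.2).trans (hk.trans (le_abs_self K₀))
      have c1 := abs_le.1 (hconv s _ _ hs (hxR e.1 i) (hxR e.2.1 i))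
      have c2 := abs_le.1 (hconv t _ _ ht (hxR e'.1 i) (hxR e'.2.1 i))
      have c3 := abs_le.1 (hlab s _ hs (hK₀ e he i))
      have c4 := abs_le.1 (hlab t _ ht (hK₀ e' he' i))
      rw [Pi.sub_apply, Int.cast_sub, abs_le]
      constructor <;> linarith
    obtain ⟨h1, h2⟩ := h₀.endpoint_of_formal he he'
      (h x hx _ (Or.inr ⟨((e, e'), m' - m), ⟨⟨he, he'⟩, hb⟩, rfl⟩)) hne hs ht hst.symm
    refine ⟨?_, ?_⟩
    · rcases h1 with rfl | rfl
      · left; simp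
      · right; module
    · rw [← hst]
      rcases h2 with rfl | rfl
      · left; simp
      · right; module

/-- The part of the complement of a real algebraic hypersurface in a cube has finitely many path
classes, provided that the hypersurface contains the faces of the cube. -/
theorem finitelyManyPathClasses_eval_ne_zero_inter_cube {σ : Type*} [Fintype σ]
    {f : MvPolynomial σ ℝ} (hf : f ≠ 0) {R : ℝ}
    (hR : ∀ x, MvPolynomial.eval x f ≠ 0 → ∀ p, |x p| ≠ R) :
    FinitelyManyPathClasses ({x | MvPolynomial.eval x f ≠ 0} ∩ {x | ∀ p, |x p| < R}) := by
  refine (finitelyManyPathClasses_eval_ne_zero hf).inter_of_locally_iff fun z hz => ?_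
  by_cases h : ∀ p, |z p| < R
  · have : ∀ᶠ w in 𝓝 z, ∀ p, |w p| < R := Filter.eventually_all.2 fun p =>
      (continuous_abs.comp (continuous_apply p)).continuousAt.eventually_lt
        continuousAt_const (h p)
    filter_upwards [this] with w hw _
    exact ⟨fun _ => h, fun _ => hw⟩
  · have h' := h
    push Not at h'
    obtain ⟨p, hp⟩ := h'
    have hp' : R < |z p| := lt_of_le_of_ne hp (hR z hz p).symm
    have : ∀ᶠ w in 𝓝 z, R < |w p| := continuousAt_const.eventually_lt
      (continuous_abs.comp (continuous_apply p)).continuousAt hp'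
    filter_upwards [this] with w hw _
    exact ⟨fun hw' => absurd (hw' p) (not_lt.2 hw.le), fun hz' => absurd hz' h⟩

theorem exists_eval_ne_zero_and_eval_sub_ne_zero {σ : Type*} {f g : MvPolynomial σ ℝ}
    (hf : f ≠ 0) (hg : g ≠ 0) (w : σ → ℝ) :
    ∃ y, MvPolynomial.eval y f ≠ 0 ∧ MvPolynomial.eval (y - w) g ≠ 0 := by
  let g' : MvPolynomial σ ℝ :=
    MvPolynomial.bind₁ (fun i => MvPolynomial.X i - MvPolynomial.C (w i)) g
  have hg' : ∀ y, MvPolynomial.eval y g' = MvPolynomial.eval (y - w) g := fun y => by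
    simp only [g', MvPolynomial.eval, MvPolynomial.eval₂Hom_bind₁]
    congr 2
    ext i
    simp
  have hne : g' ≠ 0 := fun h0 => by
    obtain ⟨z, hz⟩ := exists_eval_ne_zero hg
    have := hg' (z + w)
    rw [h0, map_zero, add_sub_cancel_right] at this
    exact hz this.symm
  obtain ⟨y, hy⟩ := exists_eval_ne_zero (mul_ne_zero hf hne)
  rw [map_mul, mul_ne_zero_iff, hg'] at hy
  exact ⟨y, hy⟩

/-- The proper placements in the torus form finitely many path classes. -/
theorem finitelyManyPathClasses_properPlacement {n : ℕ}
    (E : Finset (Fin n × Fin n × (Fin 3 → ℤ))) :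
    FinitelyManyPathClasses
      ((fun x : Fin n → Fin 3 → ℝ => fun u i => ((x u i : ℝ) : AddCircle (1 : ℝ))) ''
        {x | ProperPlacement E x}) := by
  rcases ({x | ProperPlacement E x} : Set (Fin n → Fin 3 → ℝ)).eq_empty_or_nonempty with
    hP | ⟨x₀, h₀⟩
  · rw [hP, image_empty]
    exact ⟨∅, finite_empty, by simp⟩
  obtain ⟨f, hf, hfP⟩ := ProperPlacement.exists_mvPolynomial h₀ 2
  let F : MvPolynomial (Fin n × Fin 3) ℝ :=
    f * ∏ p, (MvPolynomial.X p ^ 2 - MvPolynomial.C 4)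
  have hF : F ≠ 0 := by
    refine mul_ne_zero hf (Finset.prod_ne_zero_iff.2 fun p _ h0 => ?_)
    have := congrArg (MvPolynomial.eval (fun _ => (0 : ℝ))) h0
    simp at this
  have hFf : ∀ x, MvPolynomial.eval x F ≠ 0 → MvPolynomial.eval x f ≠ 0 := fun x hx => by
    rw [map_mul] at hx
    exact left_ne_zero_of_mul hx
  have hface : ∀ x, MvPolynomial.eval x F ≠ 0 → ∀ p, |x p| ≠ 2 := by
    intro x hx p hp
    rw [map_mul, map_prod] at hx
    refine (Finset.prod_ne_zero_iff.1 (right_ne_zero_of_mul hx)) p (Finset.mem_univ p) ?_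
    have : x p ^ 2 = 4 := by rw [← sq_abs, hp]; norm_num
    simp [this]
  let π : (Fin n × Fin 3 → ℝ) → Fin n → Fin 3 → AddCircle (1 : ℝ) :=
    fun z u i => ((z (u, i) : ℝ) : AddCircle (1 : ℝ))
  have hπ : Continuous π := continuous_pi fun u => continuous_pi fun i =>
    (AddCircle.continuous_mk' (1 : ℝ)).comp (continuous_apply (u, i))
  refine ((finitelyManyPathClasses_eval_ne_zero_inter_cube hF hface).image hπ).of_reachable ?_ ?_
  · rintro _ ⟨z, ⟨hzF, hz2⟩, rfl⟩
    exact ⟨fun u i => z (u, i), hfP _ (fun u i => hz2 (u, i)) (hFf z hzF), rfl⟩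
  · rintro _ ⟨x, hx, rfl⟩
    let z : Fin n × Fin 3 → ℝ := fun p => x p.1 p.2
    let w : Fin n × Fin 3 → ℝ := fun p => (⌊z p⌋ : ℝ)
    obtain ⟨R, hR⟩ : ∃ R, ∀ p, |z p| < R :=
      ⟨‖z‖ + 1, fun p => (norm_le_pi_norm z p).trans_lt (lt_add_one _)⟩
    obtain ⟨g, hg, hgP⟩ := ProperPlacement.exists_mvPolynomial h₀ R
    obtain ⟨y, hyg, hyF⟩ := exists_eval_ne_zero_and_eval_sub_ne_zero hg hF w
    let γ : ℝ → Fin n × Fin 3 → ℝ := fun t p => z p + t * (y p - z p)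
    have hγ : Continuous γ := by fun_prop
    have hγ0 : γ 0 = z := by ext p; simp [γ]
    have hγR : ∀ᶠ t in 𝓝 (0 : ℝ), ∀ p, |γ t p| < R ∧ |γ t p - w p| < 2 := by
      refine Filter.eventually_all.2 fun p => ?_
      have hc : Continuous fun t => γ t p := (continuous_apply p).comp hγ
      refine (hc.abs.continuousAt.eventually_lt continuousAt_const ?_).and
        ((hc.sub continuous_const).abs.continuousAt.eventually_lt continuousAt_const ?_)
      · simpa [hγ0] using hR p
      · change |γ 0 p - w p| < 2
        rw [hγ0, abs_lt]
        constructor <;> linarith [Int.floor_le (z p), Int.lt_floor_add_one (z p)]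
    have hγF : ∀ᶠ t in 𝓝[>] (0 : ℝ), MvPolynomial.eval (γ t - w) F ≠ 0 := by
      filter_upwards [eventually_eval_lineMap_ne_zero F (z - w) hyF] with t ht
      convert ht using 3
      ext p
      simp only [γ, Pi.sub_apply]
      ring
    obtain ⟨ε, hε, hεsub⟩ := mem_nhdsGT_iff_exists_Ioo_subset.1
      (((eventually_eval_lineMap_ne_zero g z hyg).and hγF).and (nhdsWithin_le_nhds hγR))
    have hε0 : 0 < ε := hε
    have hpath : JoinedIn {x | ProperPlacement E x} x (fun u i => γ (ε / 2) (u, i)) := by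
      have hj := JoinedIn.image_of_continuous (S := Icc 0 (ε / 2))
        (T := {x | ProperPlacement E x}) (JoinedIn.of_segment_subset
          (segment_eq_Icc (by positivity : (0 : ℝ) ≤ ε / 2)).subset)
        (φ := fun t u i => γ t (u, i))
        (continuous_pi fun u => continuous_pi fun i => (continuous_apply (u, i)).comp hγ)
        (fun t ht => by
          rcases ht.1.eq_or_lt with rfl | hpos
          · change (fun u i => γ 0 (u, i)) ∈ {x | ProperPlacement E x}
            rw [hγ0]; exact hx
          · have h1 := hεsub ⟨hpos, by linarith [ht.2]⟩
            exact hgP _ (fun u i => (h1.2 (u, i)).1) h1.1.1)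
      change JoinedIn _ (fun u i => γ 0 (u, i)) _ at hj
      rw [hγ0] at hj
      exact hj
    have hend := hεsub (⟨by linarith, by linarith⟩ : ε / 2 ∈ Ioo 0 ε)
    refine ⟨π (γ (ε / 2)), ⟨γ (ε / 2) - w, ⟨hend.1.2, fun p => (hend.2 p).2⟩, ?_⟩, ?_⟩
    · ext u i
      simp only [π, w, Pi.sub_apply, AddCircle.coe_sub, sub_eq_self]
      rw [AddCircle.coe_eq_zero_iff]
      exact ⟨⌊z (u, i)⌋, by simp⟩
    · exact hpath.image_of_continuous
        (φ := fun (x : Fin n → Fin 3 → ℝ) u i => ((x u i : ℝ) : AddCircle (1 : ℝ)))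
        (continuous_pi fun u => continuous_pi fun i => (AddCircle.continuous_mk' (1 : ℝ)).comp
          ((continuous_apply i).comp (continuous_apply u))) (mapsTo_image _ _)

theorem stmt1 (n : ℕ) (hn : 1 ≤ n) (E : Finset (Fin n × Fin n × (Fin 3 → ℤ))) :
    Finite (ConnectedComponents
      (↥((fun x : Fin n → Fin 3 → ℝ => fun u i => ((x u i : ℝ) : AddCircle (1 : ℝ))) ''
        {x | ProperPlacement E x}))) :=
  (finitelyManyPathClasses_properPlacement E).finite_connectedComponents
end

section
/- The number of orbits of the translation action of the group (ℤ/6ℤ)³ on the set X(6) of patterns is 2424. -/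
/-- A pattern in the discrete torus `(ℤ/nℤ)³` is a set of `n` points any two distinct
members of which differ in all three coordinates. -/
def IsPattern (n : ℕ) (A : Finset (Fin 3 → ZMod n)) : Prop :=
  A.card = n ∧ ∀ x ∈ A, ∀ y ∈ A, x ≠ y → ∀ i, x i ≠ y i

/-- The orbit of a pattern under the translation action of `(ℤ/nℤ)³`. -/
def orbitOf (n : ℕ) (A : Finset (Fin 3 → ZMod n)) : Set (Finset (Fin 3 → ZMod n)) :=
  { B | ∃ g : Fin 3 → ZMod n, B = A.image (fun x => x + g) }

/-- The set of orbits of the translation action of `(ℤ/nℤ)³` on the set of patterns. -/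
def orbitsOfPatterns (n : ℕ) : Set (Set (Finset (Fin 3 → ZMod n))) :=
  { O | ∃ A : Finset (Fin 3 → ZMod n), IsPattern n A ∧ O = orbitOf n A }

/-- The permutations conjugating `p` to `q` are counted by the centralizer of `p` as soon as there
is one. -/
theorem Equiv.Perm.card_conjugators {α : Type*} [Fintype α] [DecidableEq α] (p q : Equiv.Perm α) :
    Fintype.card {s : Equiv.Perm α // q * s = s * p} =
      if p.cycleType = q.cycleType then
        (Fintype.card α - p.cycleType.sum).factorial * p.cycleType.prod *
          ∏ k ∈ p.cycleType.toFinset, (p.cycleType.count k).factorial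
      else 0 := by
  split_ifs with h
  · obtain ⟨c, hc⟩ := isConj_iff.1 (Equiv.Perm.isConj_iff_cycleType_eq.2 h)
    rw [← Equiv.Perm.nat_card_centralizer, ← Nat.card_eq_fintype_card]
    refine Nat.card_congr ((Equiv.mulLeft c⁻¹).subtypeEquiv fun s => ?_)
    rw [Subgroup.mem_centralizer_singleton_iff, ← hc, Equiv.coe_mulLeft]
    constructor
    · intro hs
      calc c⁻¹ * s * p = c⁻¹ * (s * p) := mul_assoc _ _ _
        _ = p * (c⁻¹ * s) := by rw [← hs]; group
    · intro hs
      calc c * p * c⁻¹ * s = c * (p * (c⁻¹ * s)) := by group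
        _ = s * p := by rw [← hs]; group
  · rw [Fintype.card_eq_zero_iff]
    refine ⟨fun s => h (Equiv.Perm.isConj_iff_cycleType_eq.1 (isConj_iff.2 ⟨s.1, ?_⟩))⟩
    rw [← s.2, mul_inv_cancel_right]

/-- A pair of permutations of `ℤ/nℤ`; its graph is a pattern. -/
def PermPair (n : ℕ) : Type := Fin 2 → Equiv.Perm (ZMod n)

namespace PermPair

variable {n : ℕ}

instance [NeZero n] : Fintype (PermPair n) :=
  inferInstanceAs (Fintype (Fin 2 → Equiv.Perm (ZMod n)))

instance [NeZero n] : DecidableEq (PermPair n) :=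
  inferInstanceAs (DecidableEq (Fin 2 → Equiv.Perm (ZMod n)))

/-- The action on pairs of permutations corresponding to translation of their graphs. -/
instance : AddAction (Fin 3 → ZMod n) (PermPair n) where
  vadd g p := fun j => Equiv.addRight (g j.succ) * p j * Equiv.addRight (-g 0)
  zero_vadd p := by
    funext j
    ext x
    change p j (x + -0) + 0 = p j x
    simp
  add_vadd g h p := by
    funext j
    ext x
    change p j (x + -(g 0 + h 0)) + (g j.succ + h j.succ) =
      p j (x + -g 0 + -h 0) + h j.succ + g j.succ
    rw [neg_add, add_assoc x, add_assoc (p j _), add_comm (g j.succ)]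

theorem vadd_apply (g : Fin 3 → ZMod n) (p : PermPair n) (j : Fin 2) (x : ZMod n) :
    (g +ᵥ p) j x = p j (x - g 0) + g j.succ := by
  rw [sub_eq_add_neg]
  rfl

theorem vadd_eq_iff (g : Fin 3 → ZMod n) (p : PermPair n) :
    g +ᵥ p = p ↔ ∀ j, Equiv.addRight (g j.succ) * p j = p j * Equiv.addRight (g 0) := by
  refine funext_iff.trans (forall_congr' fun j => ?_)
  rw [Equiv.ext_iff, Equiv.ext_iff, ← (Equiv.addRight (g 0)).forall_congr_right]
  simp [vadd_apply]

variable [NeZero n]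

/-- The points `(x, p 0 x, p 1 x)`. -/
def graph (p : PermPair n) : Finset (Fin 3 → ZMod n) :=
  Finset.univ.filter fun v => ∀ j : Fin 2, v j.succ = p j (v 0)

theorem mem_graph {p : PermPair n} {v : Fin 3 → ZMod n} :
    v ∈ p.graph ↔ ∀ j : Fin 2, v j.succ = p j (v 0) := by
  simp [graph]

theorem graph_eq_image (p : PermPair n) :
    p.graph = Finset.univ.image fun x => (Fin.cons x fun j => p j x : Fin 3 → ZMod n) := by
  ext v
  simp only [mem_graph, Finset.mem_image, Finset.mem_univ, true_and]
  constructor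
  · intro h
    exact ⟨v 0, funext fun i => Fin.cases rfl (fun j => (h j).symm) i⟩
  · rintro ⟨x, rfl⟩ j
    simp

theorem card_graph (p : PermPair n) : p.graph.card = n := by
  rw [graph_eq_image, Finset.card_image_of_injective, Finset.card_univ, ZMod.card]
  intro x y h
  exact congrFun h 0

theorem graph_injective : Function.Injective (graph (n := n)) := by
  intro p q h
  funext j
  ext x
  have hx : (Fin.cons x fun j => p j x : Fin 3 → ZMod n) ∈ p.graph := by simp [mem_graph]
  rw [h, mem_graph] at hx
  simpa using hx j

theorem isPattern_graph (p : PermPair n) : IsPattern n p.graph := by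
  refine ⟨p.card_graph, fun v hv w hw hne => ?_⟩
  rw [mem_graph] at hv hw
  have h0 : v 0 ≠ w 0 := fun h =>
    hne (funext fun i => Fin.cases h (fun j => by rw [hv, hw, h]) i)
  refine fun i => Fin.cases h0 (fun j => ?_) i
  rw [hv, hw]
  exact (p j).injective.ne h0

theorem exists_graph_eq {A : Finset (Fin 3 → ZMod n)} (hA : IsPattern n A) :
    ∃ p : PermPair n, p.graph = A := by
  have hbij (i : Fin 3) : Function.Bijective fun v : A => v.1 i := by
    rw [Fintype.bijective_iff_injective_and_card]
    refine ⟨fun v w h => ?_, by simp [hA.1]⟩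
    by_contra hne
    exact hA.2 v.1 v.2 w.1 w.2 (fun e => hne (Subtype.ext e)) i h
  let e (i : Fin 3) : A ≃ ZMod n := Equiv.ofBijective _ (hbij i)
  let p : PermPair n := fun j => (e 0).symm.trans (e j.succ)
  refine ⟨p, (Finset.eq_of_subset_of_card_le (fun v hv => ?_) ?_).symm⟩
  · rw [mem_graph]
    intro j
    change e j.succ ⟨v, hv⟩ = e j.succ ((e 0).symm (e 0 ⟨v, hv⟩))
    rw [Equiv.symm_apply_apply]
  · rw [card_graph, hA.1]

theorem graph_vadd (g : Fin 3 → ZMod n) (p : PermPair n) :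
    (g +ᵥ p).graph = p.graph.image fun x => x + g := by
  ext v
  simp only [Finset.mem_image, mem_graph, vadd_apply]
  constructor
  · intro h
    exact ⟨v - g, fun j => by simp [h j], sub_add_cancel v g⟩
  · rintro ⟨w, hw, rfl⟩ j
    simp [hw j]

theorem orbitOf_graph (p : PermPair n) :
    orbitOf n p.graph = graph '' AddAction.orbit (Fin 3 → ZMod n) p := by
  ext B
  simp only [orbitOf, Set.mem_ofPred_eq, ← graph_vadd, Set.mem_image, AddAction.mem_orbit_iff,
    exists_exists_eq_and]
  exact exists_congr fun g => eq_comm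

theorem ncard_orbitsOfPatterns :
    Set.ncard (orbitsOfPatterns n) =
      Nat.card (Quotient (AddAction.orbitRel (Fin 3 → ZMod n) (PermPair n))) := by
  let f : Quotient (AddAction.orbitRel (Fin 3 → ZMod n) (PermPair n)) →
      Set (Finset (Fin 3 → ZMod n)) := fun q => graph '' AddAction.orbitRel.Quotient.orbit q
  have hf : Function.Injective f :=
    graph_injective.image_injective.comp AddAction.orbitRel.Quotient.orbit_injective
  rw [← Nat.card_range_of_injective hf]
  congr 1
  ext O
  constructor
  · rintro ⟨A, hA, rfl⟩
    obtain ⟨p, rfl⟩ := exists_graph_eq hA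
    exact ⟨Quotient.mk _ p, (orbitOf_graph p).symm⟩
  · rintro ⟨q, rfl⟩
    induction q using Quotient.inductionOn with
    | h p => exact ⟨p.graph, p.isPattern_graph, (orbitOf_graph p).symm⟩

theorem card_fixedBy (g : Fin 3 → ZMod n) :
    Fintype.card (AddAction.fixedBy (PermPair n) g) =
      ∏ j : Fin 2, Fintype.card {s : Equiv.Perm (ZMod n) //
        Equiv.addRight (g j.succ) * s = s * Equiv.addRight (g 0)} := by
  rw [← Fintype.card_pi]
  exact Fintype.card_congr <| (Equiv.subtypeEquivRight (vadd_eq_iff g)).trans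
    (Equiv.subtypePiEquivPi (p := fun (j : Fin 2) (s : Equiv.Perm (ZMod n)) =>
      Equiv.addRight (g j.succ) * s = s * Equiv.addRight (g 0)))

end PermPair

/-- The cycle types of the translations of `ℤ/6ℤ`. -/
def translationCycleType : ZMod 6 → Multiset ℕ :=
  ![0, {6}, {3, 3}, {2, 2, 2}, {3, 3}, {6}]

theorem cycleType_addRight (a : ZMod 6) :
    (Equiv.addRight a : Equiv.Perm (ZMod 6)).cycleType = translationCycleType a := by
  revert a
  decide +kernel

theorem stmt15 : Set.ncard (orbitsOfPatterns 6) = 2424 := by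
  classical
  have burnside := AddAction.sum_card_fixedBy_eq_card_orbits_mul_card_addGroup
    (Fin 3 → ZMod 6) (PermPair 6)
  simp only [PermPair.card_fixedBy, Equiv.Perm.card_conjugators, cycleType_addRight] at burnside
  have total : ∑ g : Fin 3 → ZMod 6, ∏ j : Fin 2,
      (if translationCycleType (g 0) = translationCycleType (g j.succ) then
        (Fintype.card (ZMod 6) - (translationCycleType (g 0)).sum).factorial *
          (translationCycleType (g 0)).prod *
          ∏ k ∈ (translationCycleType (g 0)).toFinset,
            ((translationCycleType (g 0)).count k).factorial
      else 0) = 2424 * 216 := by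
    decide +kernel
  have group_card : Fintype.card (Fin 3 → ZMod 6) = 216 := by simp [ZMod.card]
  rw [total, group_card] at burnside
  rw [PermPair.ncard_orbitsOfPatterns, Nat.card_eq_fintype_card]
  exact (Nat.eq_of_mul_eq_mul_right (by norm_num) burnside).symm
end
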